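/- Let M, m, k be integers with M ≥ 1, m ≥ 0, k ≥ 1 and M² = m² + 3mk + 3k². Then none of the three integers k, m+k, m+2k is divisible by M. (In particular 0 < k < M, 0 < m+k < 2M with m+k ≠ M, and 0 < m+2k < 2M with m+2k ≠ M.) -/

import Mathlib

/-- If `M ≥ 1`, `m ≥ 0`, `k ≥ 1` and `M² = m² + 3mk + 3k²`, then none of `k`, `m+k`,
`m+2k` is divisible by `M`; in particular `0 < k < M`, `0 < m+k < 2M` with `m+k ≠ M`,
and `0 < m+2k < 2M` with `m+2k ≠ M`. -/
theorem not_dvd_of_quadratic_relation (M m k : ℤ) (hM : 1 ≤ M) (hm : 0 ≤ m) (hk : 1 ≤ k)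
    (h : M ^ 2 = m ^ 2 + 3 * m * k + 3 * k ^ 2) :
    (¬ M ∣ k ∧ ¬ M ∣ (m + k) ∧ ¬ M ∣ (m + 2 * k)) ∧
    (0 < k ∧ k < M ∧
     0 < m + k ∧ m + k < 2 * M ∧ m + k ≠ M ∧
     0 < m + 2 * k ∧ m + 2 * k < 2 * M ∧ m + 2 * k ≠ M) := by
  have hmk : 0 ≤ m * k := by positivity
  have hkk : 0 < k ^ 2 := by positivity
  have upper : m + k < M := lt_of_pow_lt_pow_left₀ 2 (by lia) (by nlinarith)
  have lower : M < m + 2 * k := lt_of_pow_lt_pow_left₀ 2 (by lia) (by nlinarith)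
  refine ⟨⟨fun hd => ?_, fun hd => ?_, fun hd => ?_⟩, by lia⟩
  · have := Int.le_of_dvd (by lia) hd
    lia
  · have := Int.le_of_dvd (by lia) hd
    lia
  · have := Int.le_of_dvd (by lia) (dvd_sub_self_right.mpr hd)
    lia
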